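/- For every generic symmetric network congestion game on an extension-parallel graph, an outcome is a subgame-perfect outcome if and only if it is a Nash equilibrium. -/

import Mathlib

/-- A congestion game with `n` players on a finite resource type `R`:
each player has a finite set of actions (each action a set of resources),
and each resource has a delay function `ℕ → ℝ`. -/
structure CGame (R : Type) [DecidableEq R] [Fintype R] (n : ℕ) where
  actions : Fin n → Finset (Finset R)
  delay : R → ℕ → ℝ

namespace CGame

variable {R : Type} [DecidableEq R] [Fintype R] {n : ℕ}

/-- The congestion `x(A)_r`: number of players using resource `r` in profile `A`. -/
def congestion (_G : CGame R n) (A : Fin n → Finset R) (r : R) : ℕ :=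
  (Finset.univ.filter fun i => r ∈ A i).card

/-- The cost of player `i` in profile `A`. -/
def cost (G : CGame R n) (A : Fin n → Finset R) (i : Fin n) : ℝ :=
  ∑ r ∈ A i, G.delay r (G.congestion A r)

/-- `A` is an outcome: each player plays one of his actions. -/
def IsOutcome (G : CGame R n) (A : Fin n → Finset R) : Prop :=
  ∀ i, A i ∈ G.actions i

/-- `A` is a (pure) Nash equilibrium. -/
def IsNash (G : CGame R n) (A : Fin n → Finset R) : Prop :=
  G.IsOutcome A ∧ ∀ i, ∀ B ∈ G.actions i, G.cost A i ≤ G.cost (Function.update A i B) i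

/-- The subgame induced by the first player playing `a`. -/
def subgame (G : CGame R (n + 1)) (a : Finset R) : CGame R n where
  actions := fun i => G.actions i.succ
  delay := fun r y => G.delay r (y + if r ∈ a then 1 else 0)

/-- The subgame induced by the first `m` players playing `P`. -/
def subgameMany {m k : ℕ} (G : CGame R (m + k)) (P : Fin m → Finset R) : CGame R k where
  actions := fun i => G.actions (Fin.natAdd m i)
  delay := fun r y => G.delay r (y + (Finset.univ.filter fun i : Fin m => r ∈ P i).card)

/-- `G^k`: the game on the first `min k n` players. -/
def truncate (G : CGame R n) (k : ℕ) : CGame R (min k n) where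
  actions := fun i => G.actions (Fin.castLE (min_le_right k n) i)
  delay := G.delay

/-- The game reordered so that the player in position `i` is player `σ i`. -/
def reorder (G : CGame R n) (σ : Equiv.Perm (Fin n)) : CGame R n where
  actions := fun i => G.actions (σ i)
  delay := G.delay

/-- Subgame-perfect outcomes with respect to the order `1, …, n`. -/
def IsSPO : {n : ℕ} → CGame R n → (Fin n → Finset R) → Prop
  | 0, _, _ => True
  | _ + 1, G, A =>
      A 0 ∈ G.actions 0 ∧
      ∃ f : Finset R → (Fin _ → Finset R),
        (∀ a ∈ G.actions 0, IsSPO (G.subgame a) (f a)) ∧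
        f (A 0) = Fin.tail A ∧
        ∀ a ∈ G.actions 0,
          G.cost (Fin.cons (A 0) (f (A 0))) 0 ≤ G.cost (Fin.cons a (f a)) 0

/-- `k`-lookahead outcomes with respect to the order `1, …, n`. -/
def IsKLA (k : ℕ) : {n : ℕ} → CGame R n → (Fin n → Finset R) → Prop
  | 0, _, _ => True
  | n + 1, G, A =>
      (∃ (hk : 0 < min k (n + 1)) (B : Fin (min k (n + 1)) → Finset R),
          IsSPO (G.truncate k) B ∧ B ⟨0, hk⟩ = A 0) ∧
      IsKLA k (G.subgame (A 0)) (Fin.tail A)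

/-- `A` is a subgame-perfect outcome of `G` with respect to some order of the players. -/
def IsSPOutcome (G : CGame R n) (A : Fin n → Finset R) : Prop :=
  ∃ σ : Equiv.Perm (Fin n), IsSPO (G.reorder σ) (A ∘ σ)

/-- `A` is a `k`-lookahead outcome of `G` with respect to some order of the players. -/
def IsKLO (k : ℕ) (G : CGame R n) (A : Fin n → Finset R) : Prop :=
  ∃ σ : Equiv.Perm (Fin n), IsKLA k (G.reorder σ) (A ∘ σ)

/-- The cost of player `i` when only the players in `s` play (profile restricted to `s`). -/
def costOn (G : CGame R n) (s : Finset (Fin n)) (A : Fin n → Finset R) (i : Fin n) : ℝ :=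
  ∑ r ∈ A i, G.delay r ((s.filter fun j => r ∈ A j).card)

/-- `G` is generic: in every restriction of the game to a subset of the players,
a player's cost changes whenever his own action changes. -/
def Generic (G : CGame R n) : Prop :=
  ∀ s : Finset (Fin n), ∀ A B : Fin n → Finset R,
    (∀ i ∈ s, A i ∈ G.actions i) → (∀ i ∈ s, B i ∈ G.actions i) →
    ∀ j ∈ s, A j ≠ B j → G.costOn s A j ≠ G.costOn s B j

/-- Utilitarian social cost. -/
def SC (G : CGame R n) (A : Fin n → Finset R) : ℝ :=
  ∑ i, G.cost A i

/-- Minimum social cost over all outcomes. -/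
noncomputable def optSC (G : CGame R n) : ℝ :=
  sInf {y | ∃ A, G.IsOutcome A ∧ y = G.SC A}

/-- The `k`-Lookahead Price of Anarchy. -/
noncomputable def kLPoA (G : CGame R n) (k : ℕ) : ℝ :=
  sSup {y | ∃ A, IsKLO k G A ∧ y = G.SC A / G.optSC}

/-- The Price of Anarchy. -/
noncomputable def PoA (G : CGame R n) : ℝ :=
  sSup {y | ∃ A, G.IsNash A ∧ y = G.SC A / G.optSC}

/-- Opportunity cost `O_A` of an outcome `A` in a symmetric game with action set `𝒜`. -/
noncomputable def oppCost (G : CGame R n) (𝒜 : Finset (Finset R)) (A : Fin n → Finset R) : ℝ :=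
  sInf {y | ∃ P ∈ 𝒜, y = ∑ r ∈ P, G.delay r (G.congestion A r + 1)}

/-- Worst cost (egalitarian social cost) `W_A` of an outcome `A`. -/
noncomputable def worstCost (G : CGame R n) (A : Fin n → Finset R) : ℝ :=
  sSup {y | ∃ i, y = G.cost A i}

/-- Rosenthal's potential function. -/
def potential (G : CGame R n) (A : Fin n → Finset R) : ℝ :=
  ∑ r : R, ∑ i ∈ Finset.Icc 1 (G.congestion A r), G.delay r i

end CGame
/-- Syntax trees of extension-parallel graphs: a single arc; parallel composition;
series composition of a single arc with an EP graph (arc first or arc last). -/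
inductive EPTree : Type
  | edge : EPTree
  | parallel : EPTree → EPTree → EPTree
  | extHead : EPTree → EPTree
  | extTail : EPTree → EPTree

namespace EPTree

/-- The arcs of an extension-parallel graph. -/
def Arc : EPTree → Type
  | edge => Unit
  | parallel t₁ t₂ => t₁.Arc ⊕ t₂.Arc
  | extHead t => Unit ⊕ t.Arc
  | extTail t => t.Arc ⊕ Unit

def arcDecEq : (t : EPTree) → DecidableEq t.Arc
  | edge => inferInstanceAs (DecidableEq Unit)
  | parallel t₁ t₂ =>
      letI := t₁.arcDecEq; letI := t₂.arcDecEq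
      inferInstanceAs (DecidableEq (t₁.Arc ⊕ t₂.Arc))
  | extHead t =>
      letI := t.arcDecEq
      inferInstanceAs (DecidableEq (Unit ⊕ t.Arc))
  | extTail t =>
      letI := t.arcDecEq
      inferInstanceAs (DecidableEq (t.Arc ⊕ Unit))

instance (t : EPTree) : DecidableEq t.Arc := t.arcDecEq

def arcFintype : (t : EPTree) → Fintype t.Arc
  | edge => inferInstanceAs (Fintype Unit)
  | parallel t₁ t₂ =>
      letI := t₁.arcFintype; letI := t₂.arcFintype
      inferInstanceAs (Fintype (t₁.Arc ⊕ t₂.Arc))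
  | extHead t =>
      letI := t.arcFintype
      inferInstanceAs (Fintype (Unit ⊕ t.Arc))
  | extTail t =>
      letI := t.arcFintype
      inferInstanceAs (Fintype (t.Arc ⊕ Unit))

instance (t : EPTree) : Fintype t.Arc := t.arcFintype

/-- The set of arc sets of directed `o`–`d` paths of an extension-parallel graph. -/
def paths : (t : EPTree) → Finset (Finset t.Arc)
  | edge => {(Finset.univ : Finset Unit)}
  | parallel t₁ t₂ =>
      (t₁.paths.image fun P => P.image Sum.inl) ∪ (t₂.paths.image fun P => P.image Sum.inr)
  | extHead t => t.paths.image fun P => insert (Sum.inl ()) (P.image Sum.inr)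
  | extTail t => t.paths.image fun P => insert (Sum.inr ()) (P.image Sum.inl)

end EPTree

/-- Syntax trees of series-parallel graphs: a single arc; series composition;
parallel composition. -/
inductive SPTree : Type
  | edge : SPTree
  | series : SPTree → SPTree → SPTree
  | parallel : SPTree → SPTree → SPTree

namespace SPTree

/-- The arcs of a series-parallel graph. -/
def Arc : SPTree → Type
  | edge => Unit
  | series t₁ t₂ => t₁.Arc ⊕ t₂.Arc
  | parallel t₁ t₂ => t₁.Arc ⊕ t₂.Arc

def arcDecEq : (t : SPTree) → DecidableEq t.Arc
  | edge => inferInstanceAs (DecidableEq Unit)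
  | series t₁ t₂ =>
      letI := t₁.arcDecEq; letI := t₂.arcDecEq
      inferInstanceAs (DecidableEq (t₁.Arc ⊕ t₂.Arc))
  | parallel t₁ t₂ =>
      letI := t₁.arcDecEq; letI := t₂.arcDecEq
      inferInstanceAs (DecidableEq (t₁.Arc ⊕ t₂.Arc))

instance (t : SPTree) : DecidableEq t.Arc := t.arcDecEq

def arcFintype : (t : SPTree) → Fintype t.Arc
  | edge => inferInstanceAs (Fintype Unit)
  | series t₁ t₂ =>
      letI := t₁.arcFintype; letI := t₂.arcFintype
      inferInstanceAs (Fintype (t₁.Arc ⊕ t₂.Arc))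
  | parallel t₁ t₂ =>
      letI := t₁.arcFintype; letI := t₂.arcFintype
      inferInstanceAs (Fintype (t₁.Arc ⊕ t₂.Arc))

instance (t : SPTree) : Fintype t.Arc := t.arcFintype

/-- The set of arc sets of directed `o`–`d` paths of a series-parallel graph. -/
def paths : (t : SPTree) → Finset (Finset t.Arc)
  | edge => {(Finset.univ : Finset Unit)}
  | series t₁ t₂ =>
      (t₁.paths ×ˢ t₂.paths).image fun p => p.1.image Sum.inl ∪ p.2.image Sum.inr
  | parallel t₁ t₂ =>
      (t₁.paths.image fun P => P.image Sum.inl) ∪ (t₂.paths.image fun P => P.image Sum.inr)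

/-- A series-parallel graph is extension-parallel if in every series composition one of
the two parts is a single arc. -/
def IsEP : SPTree → Prop
  | edge => True
  | series t₁ t₂ => (t₁ = edge ∧ t₂.IsEP) ∨ (t₂ = edge ∧ t₁.IsEP)
  | parallel t₁ t₂ => t₁.IsEP ∧ t₂.IsEP

end SPTree

/-- The symmetric network congestion game with `n` players on an extension-parallel
graph `t` with delay functions `d`. -/
def SNCGep (t : EPTree) (d : t.Arc → ℕ → ℝ) (n : ℕ) : CGame t.Arc n where
  actions := fun _ => t.paths
  delay := d

/-- The symmetric network congestion game with `n` players on a series-parallel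
graph `t` with delay functions `d`. -/
def SNCGsp (t : SPTree) (d : t.Arc → ℕ → ℝ) (n : ℕ) : CGame t.Arc n where
  actions := fun _ => t.paths
  delay := d

namespace EPTree

theorem nonempty_of_mem_paths : ∀ (t : EPTree) {P : Finset t.Arc}, P ∈ t.paths → P.Nonempty
  | edge, P, h => by
      obtain rfl := Finset.mem_singleton.1 h
      exact ⟨(), Finset.mem_univ (α := Unit) ()⟩
  | parallel t₁ t₂, P, h => by
      rcases Finset.mem_union.1 h with h | h
      · obtain ⟨Q, hQ, rfl⟩ := Finset.mem_image.1 h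
        exact (t₁.nonempty_of_mem_paths hQ).image _
      · obtain ⟨Q, hQ, rfl⟩ := Finset.mem_image.1 h
        exact (t₂.nonempty_of_mem_paths hQ).image _
  | extHead t, P, h => by
      obtain ⟨Q, hQ, rfl⟩ := Finset.mem_image.1 h
      exact Finset.insert_nonempty _ _
  | extTail t, P, h => by
      obtain ⟨Q, hQ, rfl⟩ := Finset.mem_image.1 h
      exact Finset.insert_nonempty _ _

theorem paths_nonempty : ∀ t : EPTree, t.paths.Nonempty
  | edge => Finset.singleton_nonempty _
  | parallel t₁ _ => (t₁.paths_nonempty.image _).inl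
  | extHead t => t.paths_nonempty.image _
  | extTail t => t.paths_nonempty.image _

variable {t t₁ t₂ : EPTree}

/-- An arc of the first component, as an arc of the parallel composition. -/
def inlArc (t₂ : EPTree) (e : t₁.Arc) : (parallel t₁ t₂).Arc := (Sum.inl e : t₁.Arc ⊕ t₂.Arc)

/-- An arc of the second component, as an arc of the parallel composition. -/
def inrArc (t₁ : EPTree) (e : t₂.Arc) : (parallel t₁ t₂).Arc := (Sum.inr e : t₁.Arc ⊕ t₂.Arc)

/-- The additional first arc. -/
def headArc (t : EPTree) : (extHead t).Arc := (Sum.inl () : Unit ⊕ t.Arc)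

/-- An arc of the graph extended by a first arc. -/
def ofHead (e : t.Arc) : (extHead t).Arc := (Sum.inr e : Unit ⊕ t.Arc)

/-- The additional last arc. -/
def tailArc (t : EPTree) : (extTail t).Arc := (Sum.inr () : t.Arc ⊕ Unit)

/-- An arc of the graph extended by a last arc. -/
def ofTail (e : t.Arc) : (extTail t).Arc := (Sum.inl e : t.Arc ⊕ Unit)

theorem forall_arc_parallel {p : (parallel t₁ t₂).Arc → Prop} :
    (∀ e, p e) ↔ (∀ e, p (inlArc t₂ e)) ∧ ∀ e, p (inrArc t₁ e) :=
  Sum.forall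

theorem forall_arc_extHead {p : (extHead t).Arc → Prop} :
    (∀ e, p e) ↔ p (headArc t) ∧ ∀ e, p (ofHead e) :=
  Sum.forall.trans (and_congr_left' ⟨fun h => h (), fun h _ => h⟩)

theorem forall_arc_extTail {p : (extTail t).Arc → Prop} :
    (∀ e, p e) ↔ (∀ e, p (ofTail e)) ∧ p (tailArc t) :=
  Sum.forall.trans (and_congr_right' ⟨fun h => h (), fun h _ => h⟩)

/-- A path of the first component, as a path of the parallel composition. -/
def inlPath (t₂ : EPTree) (P : Finset t₁.Arc) : Finset (parallel t₁ t₂).Arc :=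
  P.map (β := t₁.Arc ⊕ t₂.Arc) Function.Embedding.inl

/-- A path of the second component, as a path of the parallel composition. -/
def inrPath (t₁ : EPTree) (P : Finset t₂.Arc) : Finset (parallel t₁ t₂).Arc :=
  P.map (β := t₁.Arc ⊕ t₂.Arc) Function.Embedding.inr

/-- A path preceded by the additional arc. -/
def headPath (P : Finset t.Arc) : Finset (extHead t).Arc :=
  Finset.disjSum (Finset.univ : Finset Unit) P

/-- A path followed by the additional arc. -/
def tailPath (P : Finset t.Arc) : Finset (extTail t).Arc :=
  Finset.disjSum P (Finset.univ : Finset Unit)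

@[simp] theorem inlArc_mem_inlPath {P : Finset t₁.Arc} {e : t₁.Arc} :
    inlArc t₂ e ∈ inlPath t₂ P ↔ e ∈ P :=
  Finset.mem_map' (β := t₁.Arc ⊕ t₂.Arc) Function.Embedding.inl

@[simp] theorem inrArc_notMem_inlPath {P : Finset t₁.Arc} {e : t₂.Arc} :
    inrArc t₁ e ∉ inlPath t₂ P := by
  intro h
  obtain ⟨_, _, h⟩ := Finset.mem_map.1 h
  exact Sum.inl_ne_inr h

@[simp] theorem inrArc_mem_inrPath {P : Finset t₂.Arc} {e : t₂.Arc} :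
    inrArc t₁ e ∈ inrPath t₁ P ↔ e ∈ P :=
  Finset.mem_map' (β := t₁.Arc ⊕ t₂.Arc) Function.Embedding.inr

@[simp] theorem inlArc_notMem_inrPath {P : Finset t₂.Arc} {e : t₁.Arc} :
    inlArc t₂ e ∉ inrPath t₁ P := by
  intro h
  obtain ⟨_, _, h⟩ := Finset.mem_map.1 h
  exact Sum.inr_ne_inl h

@[simp] theorem headArc_mem_headPath {P : Finset t.Arc} : headArc t ∈ headPath P :=
  Finset.inl_mem_disjSum.2 (Finset.mem_univ ())

@[simp] theorem ofHead_mem_headPath {P : Finset t.Arc} {e : t.Arc} :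
    ofHead e ∈ headPath P ↔ e ∈ P :=
  Finset.inr_mem_disjSum

@[simp] theorem tailArc_mem_tailPath {P : Finset t.Arc} : tailArc t ∈ tailPath P :=
  Finset.inr_mem_disjSum.2 (Finset.mem_univ ())

@[simp] theorem ofTail_mem_tailPath {P : Finset t.Arc} {e : t.Arc} :
    ofTail e ∈ tailPath P ↔ e ∈ P :=
  Finset.inl_mem_disjSum

theorem paths_parallel :
    (parallel t₁ t₂).paths = t₁.paths.image (inlPath t₂) ∪ t₂.paths.image (inrPath t₁) := by
  have h₁ : ∀ P, inlPath t₂ P = P.image (β := t₁.Arc ⊕ t₂.Arc) Sum.inl :=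
    fun P => Finset.map_eq_image _ P
  have h₂ : ∀ P, inrPath t₁ P = P.image (β := t₁.Arc ⊕ t₂.Arc) Sum.inr :=
    fun P => Finset.map_eq_image _ P
  rw [funext h₁, funext h₂]
  rfl

theorem sum_paths_parallel {M : Type*} [AddCommMonoid M] (f : Finset (parallel t₁ t₂).Arc → M) :
    ∑ P ∈ (parallel t₁ t₂).paths, f P =
      ∑ P ∈ t₁.paths, f (inlPath t₂ P) + ∑ P ∈ t₂.paths, f (inrPath t₁ P) := by
  rw [paths_parallel, Finset.sum_union, Finset.sum_image, Finset.sum_image]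
  · exact fun P _ Q _ hPQ => Finset.map_injective _ hPQ
  · exact fun P _ Q _ hPQ => Finset.map_injective _ hPQ
  · rw [Finset.disjoint_left]
    intro P hP hP'
    obtain ⟨Q, hQ, rfl⟩ := Finset.mem_image.1 hP
    obtain ⟨Q', hQ', h⟩ := Finset.mem_image.1 hP'
    obtain ⟨e, he⟩ := t₁.nonempty_of_mem_paths hQ
    exact inlArc_notMem_inrPath (h ▸ inlArc_mem_inlPath.2 he)

theorem mem_paths_parallel {P : Finset (parallel t₁ t₂).Arc} :
    P ∈ (parallel t₁ t₂).paths ↔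
      (∃ Q ∈ t₁.paths, inlPath t₂ Q = P) ∨ ∃ Q ∈ t₂.paths, inrPath t₁ Q = P := by
  rw [paths_parallel, Finset.mem_union, Finset.mem_image, Finset.mem_image]

theorem paths_extHead : (extHead t).paths = t.paths.image headPath := by
  have h : ∀ P : Finset t.Arc,
      (Finset.univ : Finset Unit).disjSum P = insert (Sum.inl () : Unit ⊕ t.Arc) (P.image Sum.inr) := by
    intro P
    ext (e | e) <;> simp
  rw [show headPath = _ from funext h]
  rfl

theorem paths_extTail : (extTail t).paths = t.paths.image tailPath := by
  have h : ∀ P : Finset t.Arc,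
      P.disjSum (Finset.univ : Finset Unit) = insert (Sum.inr () : t.Arc ⊕ Unit) (P.image Sum.inl) := by
    intro P
    ext (e | e) <;> simp
  rw [show tailPath = _ from funext h]
  rfl

theorem sum_paths_extHead {M : Type*} [AddCommMonoid M] (f : Finset (extHead t).Arc → M) :
    ∑ P ∈ (extHead t).paths, f P = ∑ P ∈ t.paths, f (headPath P) := by
  rw [paths_extHead, Finset.sum_image]
  intro P _ Q _ h
  ext e
  simpa using Finset.ext_iff.1 h (ofHead e)

theorem sum_paths_extTail {M : Type*} [AddCommMonoid M] (f : Finset (extTail t).Arc → M) :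
    ∑ P ∈ (extTail t).paths, f P = ∑ P ∈ t.paths, f (tailPath P) := by
  rw [paths_extTail, Finset.sum_image]
  intro P _ Q _ h
  ext e
  simpa using Finset.ext_iff.1 h (ofTail e)

/-- The value of a path flow. -/
def value (w : Finset t.Arc → ℕ) : ℕ := ∑ P ∈ t.paths, w P

/-- The load that a path flow puts on an arc. -/
def load (w : Finset t.Arc → ℕ) (e : t.Arc) : ℕ := ∑ P ∈ t.paths, if e ∈ P then w P else 0

section Recursion

variable (w : Finset (parallel t₁ t₂).Arc → ℕ) (u : Finset (extHead t).Arc → ℕ)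
  (v : Finset (extTail t).Arc → ℕ)

theorem value_edge (w : Finset edge.Arc → ℕ) : value w = w (Finset.univ : Finset Unit) :=
  Finset.sum_singleton _ _

theorem load_edge (w : Finset edge.Arc → ℕ) (e : edge.Arc) :
    load w e = w (Finset.univ : Finset Unit) := by
  refine (Finset.sum_singleton _ _).trans (if_pos ?_)
  exact Finset.mem_univ (α := Unit) e

theorem value_parallel :
    value w = value (fun P => w (inlPath t₂ P)) + value (fun P => w (inrPath t₁ P)) :=
  sum_paths_parallel w

theorem load_inlArc (e : t₁.Arc) :
    load w (inlArc t₂ e) = load (fun P => w (inlPath t₂ P)) e := by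
  refine (sum_paths_parallel _).trans ?_
  simp [load]

theorem load_inrArc (e : t₂.Arc) :
    load w (inrArc t₁ e) = load (fun P => w (inrPath t₁ P)) e := by
  refine (sum_paths_parallel _).trans ?_
  simp [load]

theorem value_extHead : value u = value (fun P => u (headPath P)) := sum_paths_extHead u

theorem load_headArc : load u (headArc t) = value u := by
  refine (sum_paths_extHead _).trans ?_
  rw [value_extHead u]
  simp [value]

theorem load_ofHead (e : t.Arc) :
    load u (ofHead e) = load (fun P => u (headPath P)) e := by
  refine (sum_paths_extHead _).trans ?_
  simp [load]

theorem value_extTail : value v = value (fun P => v (tailPath P)) := sum_paths_extTail v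

theorem load_tailArc : load v (tailArc t) = value v := by
  refine (sum_paths_extTail _).trans ?_
  rw [value_extTail v]
  simp [value]

theorem load_ofTail (e : t.Arc) :
    load v (ofTail e) = load (fun P => v (tailPath P)) e := by
  refine (sum_paths_extTail _).trans ?_
  simp [load]

end Recursion

theorem exists_path_load_lt (t : EPTree) (x y : Finset t.Arc → ℕ) (h : value x < value y) :
    ∃ P ∈ t.paths, x P < y P ∧ ∀ e ∈ P, load x e < load y e := by
  induction t with
  | edge =>
    rw [value_edge, value_edge] at h
    refine ⟨_, Finset.mem_singleton_self _, h, fun e _ => ?_⟩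
    rwa [load_edge, load_edge]
  | parallel t₁ t₂ ih₁ ih₂ =>
    rw [value_parallel, value_parallel] at h
    rcases lt_or_lt_of_add_lt_add h with h | h
    · obtain ⟨P, hP, hlt, hload⟩ := ih₁ _ _ h
      refine ⟨_, mem_paths_parallel.2 (Or.inl ⟨P, hP, rfl⟩), hlt, ?_⟩
      refine forall_arc_parallel.2 ⟨fun e he => ?_, fun e he => ?_⟩
      · rw [load_inlArc, load_inlArc]
        exact hload e (by simpa using he)
      · simp at he
    · obtain ⟨P, hP, hlt, hload⟩ := ih₂ _ _ h
      refine ⟨_, mem_paths_parallel.2 (Or.inr ⟨P, hP, rfl⟩), hlt, ?_⟩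
      refine forall_arc_parallel.2 ⟨fun e he => ?_, fun e he => ?_⟩
      · simp at he
      · rw [load_inrArc, load_inrArc]
        exact hload e (by simpa using he)
  | extHead t ih =>
    obtain ⟨P, hP, hlt, hload⟩ := ih _ _ (by rwa [value_extHead, value_extHead] at h)
    refine ⟨headPath P, paths_extHead ▸ Finset.mem_image_of_mem _ hP, hlt, ?_⟩
    refine forall_arc_extHead.2 ⟨fun he => ?_, fun e he => ?_⟩
    · rwa [load_headArc, load_headArc]
    · rw [load_ofHead, load_ofHead]
      exact hload e (by simpa using he)
  | extTail t ih =>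
    obtain ⟨P, hP, hlt, hload⟩ := ih _ _ (by rwa [value_extTail, value_extTail] at h)
    refine ⟨tailPath P, paths_extTail ▸ Finset.mem_image_of_mem _ hP, hlt, ?_⟩
    refine forall_arc_extTail.2 ⟨fun e he => ?_, fun he => ?_⟩
    · rw [load_ofTail, load_ofTail]
      exact hload e (by simpa using he)
    · rwa [load_tailArc, load_tailArc]

/-- The paths `P` and `Q` witness that the flow `y` can be moved towards `x` by rerouting
one unit from `P` to `Q`. -/
structure IsExchange (x y : Finset t.Arc → ℕ) (P Q : Finset t.Arc) : Prop where
  mem_left : P ∈ t.paths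
  mem_right : Q ∈ t.paths
  lt_left : x P < y P
  lt_right : y Q < x Q
  load_left : ∀ e ∈ P, e ∉ Q → load x e < load y e
  load_right : ∀ e ∈ Q, e ∉ P → load y e < load x e
  load_inter : ∀ e ∈ P, e ∈ Q → load x e = load y e

namespace IsExchange

theorem symm {x y : Finset t.Arc → ℕ} {P Q : Finset t.Arc} (h : IsExchange x y P Q) :
    IsExchange y x Q P :=
  ⟨h.mem_right, h.mem_left, h.lt_right, h.lt_left, h.load_right, h.load_left,
    fun e he he' => (h.load_inter e he' he).symm⟩

theorem inl {x y : Finset (parallel t₁ t₂).Arc → ℕ} {P Q : Finset t₁.Arc}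
    (h : IsExchange (fun P => x (inlPath t₂ P)) (fun P => y (inlPath t₂ P)) P Q) :
    IsExchange x y (inlPath t₂ P) (inlPath t₂ Q) := by
  refine ⟨mem_paths_parallel.2 (Or.inl ⟨P, h.mem_left, rfl⟩),
    mem_paths_parallel.2 (Or.inl ⟨Q, h.mem_right, rfl⟩), h.lt_left, h.lt_right, ?_, ?_, ?_⟩
  · refine forall_arc_parallel.2 ⟨fun e he he' => ?_, fun e he he' => ?_⟩
    · rw [load_inlArc, load_inlArc]
      exact h.load_left e (by simpa using he) (by simpa using he')
    · simp at he
  · refine forall_arc_parallel.2 ⟨fun e he he' => ?_, fun e he he' => ?_⟩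
    · rw [load_inlArc, load_inlArc]
      exact h.load_right e (by simpa using he) (by simpa using he')
    · simp at he
  · refine forall_arc_parallel.2 ⟨fun e he he' => ?_, fun e he he' => ?_⟩
    · rw [load_inlArc, load_inlArc]
      exact h.load_inter e (by simpa using he) (by simpa using he')
    · simp at he

theorem inr {x y : Finset (parallel t₁ t₂).Arc → ℕ} {P Q : Finset t₂.Arc}
    (h : IsExchange (fun P => x (inrPath t₁ P)) (fun P => y (inrPath t₁ P)) P Q) :
    IsExchange x y (inrPath t₁ P) (inrPath t₁ Q) := by
  refine ⟨mem_paths_parallel.2 (Or.inr ⟨P, h.mem_left, rfl⟩),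
    mem_paths_parallel.2 (Or.inr ⟨Q, h.mem_right, rfl⟩), h.lt_left, h.lt_right, ?_, ?_, ?_⟩
  · refine forall_arc_parallel.2 ⟨fun e he he' => ?_, fun e he he' => ?_⟩
    · simp at he
    · rw [load_inrArc, load_inrArc]
      exact h.load_left e (by simpa using he) (by simpa using he')
  · refine forall_arc_parallel.2 ⟨fun e he he' => ?_, fun e he he' => ?_⟩
    · simp at he
    · rw [load_inrArc, load_inrArc]
      exact h.load_right e (by simpa using he) (by simpa using he')
  · refine forall_arc_parallel.2 ⟨fun e he he' => ?_, fun e he he' => ?_⟩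
    · simp at he
    · rw [load_inrArc, load_inrArc]
      exact h.load_inter e (by simpa using he) (by simpa using he')

theorem head {x y : Finset (extHead t).Arc → ℕ} {P Q : Finset t.Arc} (hv : value x = value y)
    (h : IsExchange (fun P => x (headPath P)) (fun P => y (headPath P)) P Q) :
    IsExchange x y (headPath P) (headPath Q) := by
  refine ⟨paths_extHead ▸ Finset.mem_image_of_mem _ h.mem_left,
    paths_extHead ▸ Finset.mem_image_of_mem _ h.mem_right, h.lt_left, h.lt_right, ?_, ?_, ?_⟩
  · refine forall_arc_extHead.2 ⟨fun he he' => ?_, fun e he he' => ?_⟩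
    · simp at he'
    · rw [load_ofHead, load_ofHead]
      exact h.load_left e (by simpa using he) (by simpa using he')
  · refine forall_arc_extHead.2 ⟨fun he he' => ?_, fun e he he' => ?_⟩
    · simp at he'
    · rw [load_ofHead, load_ofHead]
      exact h.load_right e (by simpa using he) (by simpa using he')
  · refine forall_arc_extHead.2 ⟨fun he he' => ?_, fun e he he' => ?_⟩
    · rwa [load_headArc, load_headArc]
    · rw [load_ofHead, load_ofHead]
      exact h.load_inter e (by simpa using he) (by simpa using he')

theorem tail {x y : Finset (extTail t).Arc → ℕ} {P Q : Finset t.Arc} (hv : value x = value y)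
    (h : IsExchange (fun P => x (tailPath P)) (fun P => y (tailPath P)) P Q) :
    IsExchange x y (tailPath P) (tailPath Q) := by
  refine ⟨paths_extTail ▸ Finset.mem_image_of_mem _ h.mem_left,
    paths_extTail ▸ Finset.mem_image_of_mem _ h.mem_right, h.lt_left, h.lt_right, ?_, ?_, ?_⟩
  · refine forall_arc_extTail.2 ⟨fun e he he' => ?_, fun he he' => ?_⟩
    · rw [load_ofTail, load_ofTail]
      exact h.load_left e (by simpa using he) (by simpa using he')
    · simp at he'
  · refine forall_arc_extTail.2 ⟨fun e he he' => ?_, fun he he' => ?_⟩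
    · rw [load_ofTail, load_ofTail]
      exact h.load_right e (by simpa using he) (by simpa using he')
    · simp at he'
  · refine forall_arc_extTail.2 ⟨fun e he he' => ?_, fun he he' => ?_⟩
    · rw [load_ofTail, load_ofTail]
      exact h.load_inter e (by simpa using he) (by simpa using he')
    · rwa [load_tailArc, load_tailArc]

theorem exists_of_value_lt {x y : Finset (parallel t₁ t₂).Arc → ℕ}
    (h₁ : value (fun P => x (inlPath t₂ P)) < value (fun P => y (inlPath t₂ P)))
    (h₂ : value (fun P => y (inrPath t₁ P)) < value (fun P => x (inrPath t₁ P))) :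
    ∃ P Q, IsExchange x y P Q := by
  obtain ⟨P, hP, hPlt, hPload⟩ := exists_path_load_lt _ _ _ h₁
  obtain ⟨Q, hQ, hQlt, hQload⟩ := exists_path_load_lt _ _ _ h₂
  refine ⟨inlPath t₂ P, inrPath t₁ Q, mem_paths_parallel.2 (Or.inl ⟨P, hP, rfl⟩),
    mem_paths_parallel.2 (Or.inr ⟨Q, hQ, rfl⟩), hPlt, hQlt, ?_, ?_, ?_⟩
  · refine forall_arc_parallel.2 ⟨fun e he _ => ?_, fun e he _ => ?_⟩
    · rw [load_inlArc, load_inlArc]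
      exact hPload e (by simpa using he)
    · simp at he
  · refine forall_arc_parallel.2 ⟨fun e he _ => ?_, fun e he _ => ?_⟩
    · simp at he
    · rw [load_inrArc, load_inrArc]
      exact hQload e (by simpa using he)
  · refine forall_arc_parallel.2 ⟨fun e he he' => ?_, fun e he he' => ?_⟩
    · simp at he'
    · simp at he

end IsExchange

/-- Two distinct flows of equal value on an extension-parallel graph admit an exchange. -/
theorem exists_isExchange (t : EPTree) (x y : Finset t.Arc → ℕ) (hv : value x = value y)
    (hne : ∃ P ∈ t.paths, x P ≠ y P) : ∃ P Q, IsExchange x y P Q := by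
  induction t with
  | edge =>
    obtain ⟨P, hP, hne⟩ := hne
    obtain rfl := Finset.mem_singleton.1 hP
    rw [value_edge, value_edge] at hv
    exact absurd hv hne
  | parallel t₁ t₂ ih₁ ih₂ =>
    have hv' := hv
    rw [value_parallel, value_parallel] at hv'
    rcases lt_trichotomy (value fun P => x (inlPath t₂ P)) (value fun P => y (inlPath t₂ P))
      with h | h | h
    · exact IsExchange.exists_of_value_lt h (by omega)
    · have h₂ : (value fun P => x (inrPath t₁ P)) = value fun P => y (inrPath t₁ P) := by omega
      obtain ⟨P, hP, hne⟩ := hne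
      rcases mem_paths_parallel.1 hP with ⟨P, hP', rfl⟩ | ⟨P, hP', rfl⟩
      · obtain ⟨P, Q, hPQ⟩ := ih₁ _ _ h ⟨P, hP', hne⟩
        exact ⟨_, _, hPQ.inl⟩
      · obtain ⟨P, Q, hPQ⟩ := ih₂ _ _ h₂ ⟨P, hP', hne⟩
        exact ⟨_, _, hPQ.inr⟩
    · obtain ⟨P, Q, hPQ⟩ := IsExchange.exists_of_value_lt h (by omega)
      exact ⟨_, _, hPQ.symm⟩
  | extHead t ih =>
    obtain ⟨P, hP, hne⟩ := hne
    rw [paths_extHead] at hP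
    obtain ⟨P, hP', rfl⟩ := Finset.mem_image.1 hP
    have hv' := hv
    rw [value_extHead, value_extHead] at hv'
    obtain ⟨P, Q, hPQ⟩ := ih _ _ hv' ⟨P, hP', hne⟩
    exact ⟨_, _, hPQ.head hv⟩
  | extTail t ih =>
    obtain ⟨P, hP, hne⟩ := hne
    rw [paths_extTail] at hP
    obtain ⟨P, hP', rfl⟩ := Finset.mem_image.1 hP
    have hv' := hv
    rw [value_extTail, value_extTail] at hv'
    obtain ⟨P, Q, hPQ⟩ := ih _ _ hv' ⟨P, hP', hne⟩
    exact ⟨_, _, hPQ.tail hv⟩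

end EPTree

namespace CGame

section ActionCount

variable {R : Type} [DecidableEq R] {n : ℕ}

/-- The number of players choosing the action `P`. -/
def actionCount (A : Fin n → Finset R) (P : Finset R) : ℕ :=
  (Finset.univ.filter fun i => A i = P).card

theorem actionCount_comp (A : Fin n → Finset R) (σ : Equiv.Perm (Fin n)) (P : Finset R) :
    actionCount (A ∘ σ) P = actionCount A P := by
  simp only [actionCount, Finset.card_filter]
  exact Equiv.sum_comp σ fun i => if A i = P then 1 else 0

theorem exists_eq_of_actionCount_pos {A : Fin n → Finset R} {P : Finset R}
    (h : 0 < actionCount A P) : ∃ i, A i = P := by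
  obtain ⟨i, hi⟩ := Finset.card_pos.1 h
  exact ⟨i, (Finset.mem_filter.1 hi).2⟩

theorem actionCount_apply_pos (A : Fin n → Finset R) (i : Fin n) : 0 < actionCount A (A i) :=
  Finset.card_pos.2 ⟨i, Finset.mem_filter.2 ⟨Finset.mem_univ i, rfl⟩⟩

end ActionCount

section General

variable {R : Type} [DecidableEq R] [Fintype R] {n : ℕ}

theorem congestion_eq_add (G : CGame R n) (A : Fin n → Finset R) (i : Fin n) (r : R) :
    G.congestion A r =
      ((Finset.univ.erase i).filter fun j => r ∈ A j).card + if r ∈ A i then 1 else 0 := by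
  rw [congestion, ← Finset.insert_erase (Finset.mem_univ i), Finset.filter_insert]
  split_ifs <;> simp

theorem congestion_update (G : CGame R n) (A : Fin n → Finset R) (i : Fin n) (B : Finset R)
    (r : R) :
    G.congestion (Function.update A i B) r =
      ((Finset.univ.erase i).filter fun j => r ∈ A j).card + if r ∈ B then 1 else 0 := by
  rw [congestion_eq_add G _ i, Function.update_self]
  congr 2
  refine Finset.filter_congr fun j hj => ?_
  rw [Function.update_of_ne (Finset.ne_of_mem_erase hj)]

theorem cost_update (G : CGame R n) (A : Fin n → Finset R) (i : Fin n) (B : Finset R) :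
    G.cost (Function.update A i B) i =
      ∑ r ∈ B, G.delay r (G.congestion A r + if r ∈ A i then 0 else 1) := by
  rw [cost, Function.update_self]
  refine Finset.sum_congr rfl fun r hr => ?_
  rw [congestion_update, congestion_eq_add G A i, if_pos hr]
  split_ifs <;> rfl

theorem potential_eq_add (G : CGame R n) (A : Fin n → Finset R) (i : Fin n) :
    G.potential A = (∑ r, ∑ k ∈ Finset.Icc 1 ((Finset.univ.erase i).filter fun j => r ∈ A j).card,
      G.delay r k) + G.cost A i := by
  have h : G.cost A i = ∑ r, if r ∈ A i then
      G.delay r (((Finset.univ.erase i).filter fun j => r ∈ A j).card + 1) else 0 := by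
    rw [cost, ← Finset.sum_filter, Finset.filter_univ_mem]
    refine Finset.sum_congr rfl fun r hr => ?_
    rw [congestion_eq_add G A i, if_pos hr]
  rw [h, potential, ← Finset.sum_add_distrib]
  refine Finset.sum_congr rfl fun r _ => ?_
  rw [congestion_eq_add G A i]
  split_ifs
  · rw [Finset.sum_Icc_succ_top (Nat.le_add_left 1 _)]
  · simp

theorem congestion_cons (G : CGame R (n + 1)) (a : Finset R) (A : Fin n → Finset R) (r : R) :
    G.congestion (Fin.cons a A : Fin (n + 1) → Finset R) r =
      (G.subgame a).congestion A r + if r ∈ a then 1 else 0 := by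
  simp only [congestion, Finset.card_filter, Fin.sum_univ_succ, Fin.cons_zero, Fin.cons_succ]
  rw [add_comm]

theorem cost_subgame (G : CGame R (n + 1)) (a : Finset R) (A : Fin n → Finset R) (i : Fin n) :
    (G.subgame a).cost A i = G.cost (Fin.cons a A : Fin (n + 1) → Finset R) i.succ := by
  simp only [cost, congestion_cons, Fin.cons_succ]
  rfl

theorem cost_subgame_update (G : CGame R (n + 1)) (a : Finset R) (A : Fin n → Finset R)
    (i : Fin n) (B : Finset R) :
    (G.subgame a).cost (Function.update A i B) i =
      G.cost (Function.update (Fin.cons a A : Fin (n + 1) → Finset R) i.succ B) i.succ := by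
  rw [cost_subgame, Fin.cons_update]

theorem IsNash.tail {G : CGame R (n + 1)} {A : Fin (n + 1) → Finset R} (h : G.IsNash A) :
    (G.subgame (A 0)).IsNash (Fin.tail A) := by
  refine ⟨fun i => h.1 i.succ, fun i B hB => ?_⟩
  rw [cost_subgame_update, cost_subgame, Fin.cons_self_tail]
  exact h.2 i.succ B hB

theorem potential_update_sub (G : CGame R n) (A : Fin n → Finset R) (i : Fin n) (B : Finset R) :
    G.potential (Function.update A i B) - G.potential A =
      G.cost (Function.update A i B) i - G.cost A i := by
  have h : ∀ r, ((Finset.univ.erase i).filter fun j => r ∈ Function.update A i B j) =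
      (Finset.univ.erase i).filter fun j => r ∈ A j := fun r =>
    Finset.filter_congr fun j hj => by rw [Function.update_of_ne (Finset.ne_of_mem_erase hj)]
  rw [potential_eq_add G A i, potential_eq_add G _ i]
  simp only [h]
  ring

theorem exists_isNash (G : CGame R n) (hG : ∀ i, (G.actions i).Nonempty) : ∃ A, G.IsNash A := by
  obtain ⟨A, hA, hmin⟩ := (Fintype.piFinset G.actions).exists_min_image G.potential
    (Fintype.piFinset_nonempty.2 hG)
  rw [Fintype.mem_piFinset] at hA
  refine ⟨A, hA, fun i B hB => ?_⟩
  have h := hmin (Function.update A i B) <| Fintype.mem_piFinset.2 fun j => by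
    rcases eq_or_ne j i with rfl | hj
    · rwa [Function.update_self]
    · rw [Function.update_of_ne hj]
      exact hA j
  linarith [G.potential_update_sub A i B]

/-- Every unilateral deviation changes the cost of the deviating player. -/
def UnilaterallyGeneric (G : CGame R n) : Prop :=
  ∀ A, G.IsOutcome A → ∀ i, ∀ B ∈ G.actions i, B ≠ A i →
    G.cost A i ≠ G.cost (Function.update A i B) i

theorem Generic.unilaterallyGeneric {G : CGame R n} (h : G.Generic) :
    G.UnilaterallyGeneric := by
  intro A hA i B hB hne
  refine h Finset.univ A (Function.update A i B) (fun j _ => hA j) (fun j _ => ?_) i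
    (Finset.mem_univ i) (by rwa [Function.update_self, ne_comm])
  rcases eq_or_ne j i with rfl | hj
  · rwa [Function.update_self]
  · rw [Function.update_of_ne hj]
    exact hA j

theorem UnilaterallyGeneric.subgame {G : CGame R (n + 1)} (h : G.UnilaterallyGeneric)
    {a : Finset R} (ha : a ∈ G.actions 0) : (G.subgame a).UnilaterallyGeneric := by
  intro A hA i B hB hne
  rw [cost_subgame_update, cost_subgame]
  exact h (Fin.cons a A) (Fin.forall_fin_succ.2 ⟨ha, hA⟩) i.succ B hB hne

theorem congestion_comp (G : CGame R n) (A : Fin n → Finset R) (σ : Equiv.Perm (Fin n)) (r : R) :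
    G.congestion (A ∘ σ) r = G.congestion A r := by
  simp only [congestion, Finset.card_filter]
  exact Equiv.sum_comp σ fun i => if r ∈ A i then 1 else 0

theorem cost_comp (G : CGame R n) (A : Fin n → Finset R) (σ : Equiv.Perm (Fin n)) (i : Fin n) :
    G.cost (A ∘ σ) i = G.cost A (σ i) := by
  simp only [cost, congestion_comp, Function.comp_apply]

end General

section ExtensionParallel

open EPTree

variable {t : EPTree} {d : t.Arc → ℕ → ℝ} {n : ℕ} {A B : Fin n → Finset t.Arc}

theorem load_actionCount (hA : (SNCGep t d n).IsOutcome A) (e : t.Arc) :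
    load (actionCount A) e = (SNCGep t d n).congestion A e := by
  rw [congestion, Finset.card_eq_sum_card_fiberwise fun i _ => hA i]
  refine Finset.sum_congr rfl fun P _ => ?_
  rw [Finset.filter_filter]
  split_ifs with he
  · exact congrArg Finset.card (Finset.filter_congr fun i _ => by grind)
  · exact (Finset.card_eq_zero.2 (Finset.filter_eq_empty_iff.2 fun i _ => by grind)).symm

theorem value_actionCount (hA : (SNCGep t d n).IsOutcome A) : value (actionCount A) = n := by
  have h := Finset.card_eq_sum_card_fiberwise (s := Finset.univ) fun i _ => hA i
  rw [Finset.card_univ, Fintype.card_fin] at h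
  exact h.symm

theorem congestion_eq_of_actionCount_eq (hA : (SNCGep t d n).IsOutcome A)
    (hB : (SNCGep t d n).IsOutcome B) (h : ∀ P ∈ t.paths, actionCount A P = actionCount B P) :
    (SNCGep t d n).congestion A = (SNCGep t d n).congestion B := by
  funext e
  rw [← load_actionCount hA, ← load_actionCount hB]
  exact Finset.sum_congr rfl fun P hP => by rw [h P hP]

theorem exists_eq_of_actionCount_eq (hA : (SNCGep t d n).IsOutcome A)
    (h : ∀ P ∈ t.paths, actionCount A P = actionCount B P) (i : Fin n) : ∃ j, B j = A i :=
  exists_eq_of_actionCount_pos (h (A i) (hA i) ▸ actionCount_apply_pos A i)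

theorem IsNash.of_actionCount_eq (hB : (SNCGep t d n).IsNash B)
    (hA : (SNCGep t d n).IsOutcome A) (h : ∀ P ∈ t.paths, actionCount A P = actionCount B P) :
    (SNCGep t d n).IsNash A := by
  refine ⟨hA, fun i C hC => ?_⟩
  obtain ⟨j, hj⟩ := exists_eq_of_actionCount_eq hA h i
  have hle := hB.2 j C hC
  rwa [cost_update, cost, hj, ← congestion_eq_of_actionCount_eq hA hB.1 h, ← cost,
    ← cost_update] at hle

theorem IsNash.comp (hA : (SNCGep t d n).IsNash A) (σ : Equiv.Perm (Fin n)) :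
    (SNCGep t d n).IsNash (A ∘ σ) :=
  hA.of_actionCount_eq (fun i => hA.1 (σ i)) fun P _ => actionCount_comp A σ P

theorem monotone_cost_comp_sort (G : CGame t.Arc n) (A : Fin n → Finset t.Arc) :
    Monotone (G.cost (A ∘ Tuple.sort (G.cost A))) := by
  have h : G.cost (A ∘ Tuple.sort (G.cost A)) = G.cost A ∘ Tuple.sort (G.cost A) :=
    funext fun i => G.cost_comp A _ i
  rw [h]
  exact Tuple.monotone_sort _

theorem exists_isNash_monotone_cost (t : EPTree) (d : t.Arc → ℕ → ℝ) (n : ℕ) :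
    ∃ A, (SNCGep t d n).IsNash A ∧ Monotone ((SNCGep t d n).cost A) := by
  obtain ⟨A, hA⟩ := (SNCGep t d n).exists_isNash fun _ => t.paths_nonempty
  exact ⟨_, hA.comp _, monotone_cost_comp_sort _ A⟩

/-- In an outcome that uses the paths differently than an equilibrium `B` does, some player has
an improving deviation and pays more than some player does in `B`. -/
theorem exists_improving_of_actionCount_ne (hmono : ∀ r, Monotone (d r))
    (hgen : (SNCGep t d n).UnilaterallyGeneric) (hB : (SNCGep t d n).IsNash B)
    (hA : (SNCGep t d n).IsOutcome A) (hne : ∃ P ∈ t.paths, actionCount B P ≠ actionCount A P) :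
    ∃ i, (∃ C ∈ t.paths,
        (SNCGep t d n).cost (Function.update A i C) i < (SNCGep t d n).cost A i) ∧
      ∃ j, (SNCGep t d n).cost B j < (SNCGep t d n).cost A i := by
  obtain ⟨P, Q, h⟩ := exists_isExchange t (actionCount B) (actionCount A)
    ((value_actionCount hB.1).trans (value_actionCount hA).symm) hne
  obtain ⟨i, rfl⟩ := exists_eq_of_actionCount_pos (Nat.zero_lt_of_lt h.lt_left)
  obtain ⟨j, rfl⟩ := exists_eq_of_actionCount_pos (Nat.zero_lt_of_lt h.lt_right)
  have hPQ : A i ≠ B j := by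
    intro heq
    have := h.lt_left
    have := h.lt_right
    rw [heq] at *
    omega
  have hleft := h.load_left
  have hright := h.load_right
  have hinter := h.load_inter
  simp only [load_actionCount hA, load_actionCount hB.1] at hleft hright hinter
  have hdev : (SNCGep t d n).cost (Function.update A i (B j)) i ≤ (SNCGep t d n).cost B j := by
    rw [cost_update]
    refine Finset.sum_le_sum fun e he => hmono e ?_
    split_ifs with he'
    · exact (hinter e he' he).ge
    · exact hright e he he'
  have hlt : (SNCGep t d n).cost B j < (SNCGep t d n).cost (Function.update B j (A i)) j :=
    (hB.2 j _ (hA i)).lt_of_ne (hgen B hB.1 j _ (hA i) hPQ)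
  have hle : (SNCGep t d n).cost (Function.update B j (A i)) j ≤ (SNCGep t d n).cost A i := by
    rw [cost_update]
    refine Finset.sum_le_sum fun e he => hmono e ?_
    split_ifs with he'
    · exact (hinter e he he').le
    · exact hleft e he he'
  exact ⟨i, ⟨B j, hB.1 j, hdev.trans_lt (hlt.trans_le hle)⟩, j, hlt.trans_le hle⟩

/-- All equilibria use every path equally often. -/
theorem IsNash.actionCount_eq (hmono : ∀ r, Monotone (d r))
    (hgen : (SNCGep t d n).UnilaterallyGeneric) (hA : (SNCGep t d n).IsNash A)
    (hB : (SNCGep t d n).IsNash B) : ∀ P ∈ t.paths, actionCount A P = actionCount B P := by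
  by_contra! h
  obtain ⟨i, ⟨C, hC, hlt⟩, -⟩ := exists_improving_of_actionCount_ne hmono hgen hA hB.1 h
  exact (hB.2 i C hC).not_gt hlt

theorem IsNash.congestion_eq (hmono : ∀ r, Monotone (d r))
    (hgen : (SNCGep t d n).UnilaterallyGeneric) (hA : (SNCGep t d n).IsNash A)
    (hB : (SNCGep t d n).IsNash B) :
    (SNCGep t d n).congestion A = (SNCGep t d n).congestion B :=
  congestion_eq_of_actionCount_eq hA.1 hB.1 (hA.actionCount_eq hmono hgen hB)

section FirstPlayer

variable {A B : Fin (n + 1) → Finset t.Arc}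

/-- If the other players are in equilibrium given the action of the first player, then the first
player pays at least as much as in an equilibrium where he pays least, with equality only in an
equilibrium. -/
theorem IsNash.cost_zero_le_and (hmono : ∀ r, Monotone (d r))
    (hgen : (SNCGep t d (n + 1)).UnilaterallyGeneric) (hB : (SNCGep t d (n + 1)).IsNash B)
    (hmin : ∀ j, (SNCGep t d (n + 1)).cost B 0 ≤ (SNCGep t d (n + 1)).cost B j)
    (h0 : A 0 ∈ t.paths)
    (htail : ((SNCGep t d (n + 1)).subgame (A 0)).IsNash (Fin.tail A)) :
    (SNCGep t d (n + 1)).cost B 0 ≤ (SNCGep t d (n + 1)).cost A 0 ∧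
      ((SNCGep t d (n + 1)).cost A 0 ≤ (SNCGep t d (n + 1)).cost B 0 →
        (SNCGep t d (n + 1)).IsNash A) := by
  have hA : (SNCGep t d (n + 1)).IsOutcome A := Fin.forall_fin_succ.2 ⟨h0, htail.1⟩
  by_cases h : ∀ P ∈ t.paths, actionCount A P = actionCount B P
  · refine ⟨?_, fun _ => hB.of_actionCount_eq hA h⟩
    obtain ⟨j, hj⟩ := exists_eq_of_actionCount_eq hA h 0
    refine (hmin j).trans_eq ?_
    rw [cost, cost, hj, congestion_eq_of_actionCount_eq hA hB.1 h]
  · obtain ⟨i, ⟨C, hC, hlt⟩, j, hj⟩ := exists_improving_of_actionCount_ne hmono hgen hB hA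
      (by push Not at h; simpa only [ne_comm] using h)
    cases i using Fin.cases with
    | zero => exact ⟨(hmin j).trans hj.le, fun hle => absurd (hle.trans (hmin j)) hj.not_ge⟩
    | succ i =>
      have hle := htail.2 i C hC
      rw [cost_subgame_update, cost_subgame, Fin.cons_self_tail] at hle
      exact absurd hlt hle.not_gt

end FirstPlayer

/-- With respect to a fixed order, subgame-perfect outcomes are equilibria, and equilibria in which
earlier players pay less are subgame-perfect. -/
theorem isSPO_isNash_and_isNash_isSPO (t : EPTree) (n : ℕ) :
    ∀ d : t.Arc → ℕ → ℝ, (∀ r, Monotone (d r)) → (SNCGep t d n).UnilaterallyGeneric →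
      (∀ A, IsSPO (SNCGep t d n) A → (SNCGep t d n).IsNash A) ∧
      ∀ A, (SNCGep t d n).IsNash A → Monotone ((SNCGep t d n).cost A) →
        IsSPO (SNCGep t d n) A := by
  induction n with
  | zero =>
    exact fun d _ _ => ⟨fun A _ => ⟨fun i => i.elim0, fun i => i.elim0⟩, fun A _ _ => trivial⟩
  | succ n ih =>
    intro d hmono hgen
    have hmono' (a : Finset t.Arc) (r : t.Arc) :
        Monotone fun y => d r (y + if r ∈ a then 1 else 0) :=
      fun x y hxy => hmono r (Nat.add_le_add_right hxy _)
    have ih' (a : Finset t.Arc) (ha : a ∈ t.paths) :=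
      ih (fun r y => d r (y + if r ∈ a then 1 else 0)) (hmono' a) (hgen.subgame ha)
    constructor
    · rintro A ⟨h0, f, hf, hfA, hmin⟩
      obtain ⟨B, hB, hBmono⟩ := exists_isNash_monotone_cost t d (n + 1)
      have htail := (ih' _ h0).1 _ (hf _ h0)
      rw [hfA] at htail
      refine (hB.cost_zero_le_and hmono hgen (fun j => hBmono (Fin.zero_le j)) h0 htail).2 ?_
      have hcong := ((ih' _ (hB.1 0)).1 _ (hf _ (hB.1 0))).congestion_eq (hmono' _)
        (hgen.subgame (hB.1 0)) hB.tail
      have hle := hmin (B 0) (hB.1 0)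
      rw [hfA, Fin.cons_self_tail] at hle
      refine hle.trans_eq ?_
      conv_rhs => rw [← Fin.cons_self_tail B]
      simp only [cost, Fin.cons_zero, congestion_cons]
      exact Finset.sum_congr rfl fun r _ => by
        congr 2
        exact congrFun hcong r
    · intro A hA hAmono
      have hsub (a : Finset t.Arc) (ha : a ∈ t.paths) :
          ∃ B, IsSPO ((SNCGep t d (n + 1)).subgame a) B := by
        obtain ⟨B, hB, hBmono⟩ := exists_isNash_monotone_cost t
          (fun r y => d r (y + if r ∈ a then 1 else 0)) n
        exact ⟨B, (ih' a ha).2 B hB hBmono⟩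
      choose! g hg using hsub
      have htail : IsSPO ((SNCGep t d (n + 1)).subgame (A 0)) (Fin.tail A) := by
        refine (ih' _ (hA.1 0)).2 _ hA.tail fun i j hij => ?_
        have h := hAmono (Fin.succ_le_succ_iff.2 hij)
        rw [← Fin.cons_self_tail A, ← cost_subgame, ← cost_subgame] at h
        exact h
      have hf : ∀ a ∈ t.paths, IsSPO ((SNCGep t d (n + 1)).subgame a)
          (Function.update g (A 0) (Fin.tail A) a) := by
        intro a ha
        rcases eq_or_ne a (A 0) with rfl | hne
        · rwa [Function.update_self]
        · rw [Function.update_of_ne hne]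
          exact hg a ha
      refine ⟨hA.1 0, Function.update g (A 0) (Fin.tail A), hf, Function.update_self .., ?_⟩
      intro a ha
      rw [Function.update_self, Fin.cons_self_tail]
      exact (hA.cost_zero_le_and (A := Fin.cons a _) hmono hgen
        (fun j => hAmono (Fin.zero_le j)) ha ((ih' a ha).1 _ (hf a ha))).1

end ExtensionParallel

end CGame

/-- For every generic symmetric network congestion game on an
extension-parallel graph, an outcome is a subgame-perfect outcome iff it is a Nash
equilibrium. -/
theorem ep_generic_spo_iff_nash (t : EPTree) (d : t.Arc → ℕ → ℝ)
    (hmono : ∀ r, Monotone (d r)) (hnonneg : ∀ r m, 0 ≤ d r m)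
    (n : ℕ) (hgen : CGame.Generic (SNCGep t d n))
    (A : Fin n → Finset t.Arc) :
    CGame.IsSPOutcome (SNCGep t d n) A ↔ CGame.IsNash (SNCGep t d n) A := by
  have h := CGame.isSPO_isNash_and_isNash_isSPO t n d hmono hgen.unilaterallyGeneric
  constructor
  · rintro ⟨σ, hσ⟩
    have hA := (h.1 _ hσ).comp σ.symm
    rwa [Function.comp_assoc, Equiv.self_comp_symm, Function.comp_id] at hA
  · exact fun hA => ⟨_, h.2 _ (hA.comp _) (CGame.monotone_cost_comp_sort _ A)⟩
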